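/- For every finite simple graph H with no isolated vertices, the set of valid decompositions of H is nonempty, and the fractional edge cover number of H equals the minimum decomposition value: ρ(H) = min_D ρ(D), where the minimum ranges over all valid decompositions D of H. -/

import Mathlib

open SimpleGraph

/-- A graph is an odd cycle if it is isomorphic to the cycle graph on an odd number
`k ≥ 3` of vertices. -/
def IsOddCycleGraph {W : Type*} (G : SimpleGraph W) : Prop :=
  ∃ k : ℕ, Odd k ∧ 3 ≤ k ∧ Nonempty (G ≃g cycleGraph k)

/-- A graph is a `p`-star (`p ≥ 1`) if it is isomorphic to the star `K_{1,p}`. -/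
def IsStarGraph {W : Type*} (G : SimpleGraph W) : Prop :=
  ∃ p : ℕ, 1 ≤ p ∧ Nonempty (G ≃g completeBipartiteGraph (Fin 1) (Fin p))

/-- A valid decomposition of `H`: a collection of pairwise vertex-disjoint subgraphs of `H`,
each an odd cycle or a star, whose vertex sets cover all vertices of `H`. -/
structure ValidDecomposition {V : Type*} (H : SimpleGraph V) where
  t : ℕ
  comp : Fin t → H.Subgraph
  disj : ∀ i j, i ≠ j → Disjoint (comp i).verts (comp j).verts
  covers : ∀ v : V, ∃ i, v ∈ (comp i).verts
  cycleOrStar : ∀ i, IsOddCycleGraph (comp i).coe ∨ IsStarGraph (comp i).coe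

/-- `f` is a fractional edge cover of `H`: nonnegative, supported on the edges of `H`, and at
every vertex the incident weights sum to at least `1`. -/
def IsFracEdgeCover {V : Type*} [Fintype V] [DecidableEq V] (H : SimpleGraph V)
    [DecidableRel H.Adj] (f : Sym2 V → ℝ) : Prop :=
  (∀ e, 0 ≤ f e) ∧ (∀ e, e ∉ H.edgeSet → f e = 0) ∧
    ∀ v : V, 1 ≤ ∑ e ∈ H.incidenceFinset v, f e

/-- The cost of a fractional edge cover: the sum of its values over the edges of `H`. -/
def coverCost {V : Type*} [Fintype V] [DecidableEq V] (H : SimpleGraph V)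
    [DecidableRel H.Adj] (f : Sym2 V → ℝ) : ℝ :=
  ∑ e ∈ H.edgeFinset, f e

/-- The fractional edge cover number `ρ(H)`: the infimum of the costs of fractional edge
covers of `H`. -/
noncomputable def fracEdgeCoverNumber {V : Type*} [Fintype V] [DecidableEq V]
    (H : SimpleGraph V) [DecidableRel H.Adj] : ℝ :=
  sInf (coverCost H '' {f | IsFracEdgeCover H f})

open Classical in
/-- The value `ρ(D)` of a valid decomposition: `Σ k_i/2` over its odd cycles (an odd cycle of
length `k` has `k` edges) plus `Σ p_j` over its stars (a `p`-star has `p` edges). -/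
noncomputable def decompValue {V : Type*} {H : SimpleGraph V} (D : ValidDecomposition H) : ℝ :=
  ∑ i : Fin D.t,
    if IsOddCycleGraph (D.comp i).coe then ((D.comp i).edgeSet.ncard : ℝ) / 2
    else ((D.comp i).edgeSet.ncard : ℝ)

open Classical in
/-- The value of one component of a decomposition. -/
noncomputable def compVal {V : Type*} {H : SimpleGraph V} (S : H.Subgraph) : ℝ :=
  if IsOddCycleGraph S.coe then (S.edgeSet.ncard : ℝ) / 2 else (S.edgeSet.ncard : ℝ)

/-- A partial decomposition of the vertex set `S` with value at most `c`. -/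
def PartDec {V : Type*} (H : SimpleGraph V) (S : Set V) (c : ℝ) : Prop :=
  ∃ (ι : Type) (_ : Fintype ι) (comp : ι → H.Subgraph),
    (∀ i j, i ≠ j → Disjoint (comp i).verts (comp j).verts) ∧
    (∀ v, v ∈ S ↔ ∃ i, v ∈ (comp i).verts) ∧
    (∀ i, IsOddCycleGraph (comp i).coe ∨ IsStarGraph (comp i).coe) ∧
    ∑ i, compVal (comp i) ≤ c

lemma PartDec.empty {V : Type*} (H : SimpleGraph V) : PartDec H ∅ 0 :=
  ⟨Empty, inferInstance, fun i => i.elim, fun i => i.elim, by simp, fun i => i.elim, by simp⟩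

lemma PartDec.single {V : Type*} {H : SimpleGraph V} (K : H.Subgraph) (c : ℝ)
    (h : IsOddCycleGraph K.coe ∨ IsStarGraph K.coe) (hc : compVal K ≤ c) :
    PartDec H K.verts c :=
  ⟨Unit, inferInstance, fun _ => K, fun i j hij => (hij rfl).elim, by simp, fun _ => h, by simpa⟩

lemma PartDec.union {V : Type*} {H : SimpleGraph V} {S T : Set V} {a b : ℝ}
    (hS : PartDec H S a) (hT : PartDec H T b) (hd : Disjoint S T) :
    PartDec H (S ∪ T) (a + b) := by
  obtain ⟨ι, _, f, f1, f2, f3, f4⟩ := hS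
  obtain ⟨κ, _, g, g1, g2, g3, g4⟩ := hT
  have key : ∀ i j, Disjoint (f i).verts (g j).verts := by
    intro i j
    refine Set.disjoint_of_subset ?_ ?_ hd
    · intro v hv; exact (f2 v).2 ⟨i, hv⟩
    · intro v hv; exact (g2 v).2 ⟨j, hv⟩
  refine ⟨ι ⊕ κ, inferInstance, Sum.elim f g, ?_, ?_, ?_, ?_⟩
  · rintro (i | i) (j | j) hij
    · exact f1 i j (fun h => hij (by rw [h]))
    · exact key i j
    · exact (key j i).symm
    · exact g1 i j (fun h => hij (by rw [h]))
  · intro v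
    simp [f2, g2]
  · rintro (i | i)
    · exact f3 i
    · exact g3 i
  · simp only [Fintype.sum_sum_type, Sum.elim_inl, Sum.elim_inr]
    linarith

lemma PartDec.biUnion {V α : Type*} {H : SimpleGraph V} (A : Finset α) (S : α → Set V)
    (c : α → ℝ) (h : ∀ a ∈ A, PartDec H (S a) (c a))
    (hd : ∀ a ∈ A, ∀ b ∈ A, a ≠ b → Disjoint (S a) (S b)) :
    PartDec H {v | ∃ a ∈ A, v ∈ S a} (∑ a ∈ A, c a) := by
  classical
  induction A using Finset.induction_on with
  | empty => simpa using PartDec.empty H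
  | insert a A ha ih =>
    have h1 := ih (fun b hb => h b (Finset.mem_insert_of_mem hb))
      (fun b hb b' hb' => hd b (Finset.mem_insert_of_mem hb) b' (Finset.mem_insert_of_mem hb'))
    have h2 := (h a (Finset.mem_insert_self _ _)).union h1 (by
      rw [Set.disjoint_left]
      rintro v hv ⟨b, hb, hvb⟩
      exact Set.disjoint_left.1 (hd a (Finset.mem_insert_self _ _) b
        (Finset.mem_insert_of_mem hb) (by rintro rfl; exact ha hb)) hv hvb)
    rw [Finset.sum_insert ha]
    convert h2 using 1
    ext v; simp

lemma copy_ncard {V W : Type*} [Fintype W] {H : SimpleGraph V} {G : SimpleGraph W}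
    (f : Copy G H) : (f.toSubgraph.edgeSet.ncard) ≤ G.edgeSet.ncard := by
  have : f.toSubgraph.edgeSet = Sym2.map f.toHom '' G.edgeSet := by
    simp [Copy.toSubgraph]
  rw [this]
  exact Set.ncard_image_le (Set.toFinite _)

lemma compVal_le {V : Type*} {H : SimpleGraph V} (K : H.Subgraph) :
    compVal K ≤ K.edgeSet.ncard := by
  unfold compVal
  have : (0 : ℝ) ≤ K.edgeSet.ncard := by positivity
  split_ifs <;> linarith

lemma PartDec.star {V : Type*} {H : SimpleGraph V} (a : V) (B : Finset V) (hB : B.Nonempty)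
    (hadj : ∀ b ∈ B, H.Adj a b) : PartDec H (insert a (B : Set V)) B.card := by
  classical
  let e := B.equivFin
  have hne : ∀ b ∈ B, a ≠ b := fun b hb => (hadj b hb).ne
  let hom : completeBipartiteGraph (Fin 1) (Fin B.card) →g H :=
    { toFun := Sum.elim (fun _ => a) (fun i => (e.symm i : V))
      map_rel' := by
        rintro (i | i) (j | j) hij
        · simp at hij
        · exact hadj _ (e.symm j).2
        · exact (hadj _ (e.symm i).2).symm
        · simp at hij }
  let f : Copy (completeBipartiteGraph (Fin 1) (Fin B.card)) H := ⟨hom, by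
    rintro (i | i) (j | j) hij
    · congr 1; exact Subsingleton.elim _ _
    · exact (hne _ (e.symm j).2 hij).elim
    · exact (hne _ (e.symm i).2 hij.symm).elim
    · congr 1
      exact e.symm.injective (Subtype.ext hij)⟩
  have := PartDec.single f.toSubgraph B.card
    (Or.inr ⟨B.card, hB.card_pos, ⟨f.isoToSubgraph.symm⟩⟩) (by
      refine (compVal_le _).trans ?_
      have h1 := copy_ncard f
      have h2 : (completeBipartiteGraph (Fin 1) (Fin B.card)).edgeSet.ncard ≤ B.card := by
        have : (completeBipartiteGraph (Fin 1) (Fin B.card)).edgeSet ⊆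
            (Set.range fun i : Fin B.card => s(Sum.inl (0 : Fin 1), Sum.inr i)) := by
          intro e
          induction e using Sym2.ind with
          | _ x y =>
            rcases x with x | x <;> rcases y with y | y
            · simp
            · intro _; exact ⟨y, by rw [Subsingleton.elim x 0]⟩
            · intro _; exact ⟨x, by rw [Subsingleton.elim y 0, Sym2.eq_swap]⟩
            · simp
        refine (Set.ncard_le_ncard this (Set.toFinite _)).trans ?_
        rw [← Set.image_univ]
        refine (Set.ncard_image_le (Set.toFinite _)).trans ?_
        simp
      exact_mod_cast h1.trans h2)
  convert this using 1
  ext v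
  simp only [Copy.toSubgraph, Subgraph.map_verts, Subgraph.verts_top, Set.image_univ,
    Set.mem_range, Set.mem_insert_iff, Finset.mem_coe]
  constructor
  · rintro (rfl | hv)
    · exact ⟨Sum.inl 0, rfl⟩
    · exact ⟨Sum.inr (e ⟨v, hv⟩), by simp [f, hom]⟩
  · rintro ⟨i | i, rfl⟩
    · exact Or.inl rfl
    · exact Or.inr (e.symm i).2

lemma cycle_ncard (n : ℕ) : (cycleGraph (n + 3)).edgeSet.ncard = n + 3 := by
  have h := (cycleGraph (n+3)).sum_degrees_eq_twice_card_edges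
  simp only [cycleGraph_degree_three_le] at h
  rw [← coe_edgeFinset, Set.ncard_coe_finset]
  simp at h
  omega

lemma PartDec.cycle {V : Type*} {H : SimpleGraph V} (n : ℕ) (hn : Odd (n + 3))
    (x : Fin (n + 3) → V) (hx : Function.Injective x) (hadj : ∀ i, H.Adj (x i) (x (i + 1))) :
    PartDec H (Set.range x) (((n + 3 : ℕ) : ℝ) / 2) := by
  let hom : cycleGraph (n + 3) →g H :=
    { toFun := x
      map_rel' := by
        intro i j hij
        rcases cycleGraph_adj.1 hij with h | h
        · have h' := sub_eq_iff_eq_add'.1 h; rw [h']; exact (hadj j).symm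
        · have h' := sub_eq_iff_eq_add'.1 h; rw [h']; exact hadj i }
  let f : Copy (cycleGraph (n + 3)) H := ⟨hom, hx⟩
  have hodd : IsOddCycleGraph f.toSubgraph.coe :=
    ⟨n + 3, hn, by omega, ⟨f.isoToSubgraph.symm⟩⟩
  have := PartDec.single f.toSubgraph (((n + 3 : ℕ) : ℝ) / 2) (Or.inl hodd) (by
    have h1 := copy_ncard f
    rw [cycle_ncard] at h1
    rw [compVal, if_pos hodd]
    have : (f.toSubgraph.edgeSet.ncard : ℝ) ≤ ((n + 3 : ℕ) : ℝ) := by exact_mod_cast h1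
    linarith)
  convert this using 1
  ext v
  simp [f, hom]

lemma PartDec.perm {V : Type*} [Fintype V] [DecidableEq V] {H : SimpleGraph V} (σ : V → V)
    (hσ : Function.Injective σ) (R : Finset V)
    (hR : ∀ v ∈ R, σ v ∈ R ∧ H.Adj v (σ v)) : PartDec H (R : Set V) ((R.card : ℝ) / 2) := by
  induction R using Finset.strongInduction with
  | H R ih =>
  rcases R.eq_empty_or_nonempty with rfl | ⟨x, hx⟩
  · simpa using PartDec.empty H
  obtain ⟨k, hk⟩ : ∃ k, k = Function.minimalPeriod σ x := ⟨_, rfl⟩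
  have hkpos : 0 < k := hk ▸ Function.minimalPeriod_pos_of_mem_periodicPts (hσ.mem_periodicPts x)
  have hiter : ∀ i, σ^[i] x ∈ R := by
    intro i
    induction i with
    | zero => exact hx
    | succ i h => rw [Function.iterate_succ_apply']; exact (hR _ h).1
  have hadj : ∀ i, H.Adj (σ^[i] x) (σ^[i+1] x) := by
    intro i
    rw [Function.iterate_succ_apply']; exact (hR _ (hiter i)).2
  have hmod : ∀ i, σ^[i % k] x = σ^[i] x := by
    intro i; rw [hk]; exact Function.iterate_mod_minimalPeriod_eq
  have hinj : ∀ i < k, ∀ j < k, σ^[i] x = σ^[j] x → i = j := by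
    intro i hi j hj h
    rw [hk] at hi hj
    exact (Function.iterate_eq_iterate_iff_of_lt_minimalPeriod hi hj).1 h
  have hk1 : k ≠ 1 := by
    rintro rfl
    have := hmod 1
    have h0 := hadj 0
    simp at this h0
    rw [← this] at h0
    exact H.loopless.irrefl _ h0
  let O := (Finset.range k).image (fun i => σ^[i] x)
  have hOcard : O.card = k := by
    rw [Finset.card_image_of_injOn, Finset.card_range]
    intro i hi j hj h
    exact hinj i (by simpa using hi) j (by simpa using hj) h
  have hOR : O ⊆ R := by
    intro v hv
    obtain ⟨i, _, rfl⟩ := Finset.mem_image.1 hv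
    exact hiter i
  have hmemO : ∀ i, σ^[i] x ∈ O := fun i =>
    Finset.mem_image.2 ⟨i % k, Finset.mem_range.2 (Nat.mod_lt _ hkpos), hmod i⟩
  have hrest := ih (R \ O) (by
      refine Finset.sdiff_ssubset hOR ⟨x, hmemO 0⟩) (by
      intro v hv
      rw [Finset.mem_sdiff] at hv
      refine ⟨Finset.mem_sdiff.2 ⟨(hR v hv.1).1, fun h => hv.2 ?_⟩, (hR v hv.1).2⟩
      obtain ⟨i, _, hi⟩ := Finset.mem_image.1 h
      have h1 : σ^[(i + (k - 1)) + 1] x = σ v := by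
        rw [← hi, ← hmod (i + (k - 1) + 1), show i + (k - 1) + 1 = i + k by omega,
          Nat.add_mod_right, hmod]
      rw [Function.iterate_succ_apply'] at h1
      rw [← hσ h1]
      exact hmemO _)
  have hO : PartDec H (O : Set V) ((k : ℝ) / 2) := by
    rcases Nat.even_or_odd k with he | ho
    · obtain ⟨m, hm⟩ := he
      have := PartDec.biUnion (H := H) (Finset.range m)
        (fun i => insert (σ^[2 * i] x) (({σ^[2 * i + 1] x} : Finset V) : Set V)) (fun _ => 1)
        (fun i _ => by
          simpa using PartDec.star (H := H) (σ^[2 * i] x) {σ^[2 * i + 1] x} (by simp)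
            (by intro b hb; rw [Finset.mem_singleton.1 hb]; exact hadj _))
        (by
          intro i hi j hj hij
          have hi' := Finset.mem_range.1 hi
          have hj' := Finset.mem_range.1 hj
          rw [Set.disjoint_left]
          intro v hv hw
          simp only [Finset.coe_singleton, Set.mem_insert_iff, Set.mem_singleton_iff] at hv hw
          rcases hv with rfl | rfl <;> rcases hw with h | h <;>
          · have := hinj _ (by omega) _ (by omega) h
            omega)
      convert this using 1
      · ext v
        simp only [O, Finset.coe_image, Finset.coe_singleton, Set.mem_image, Finset.mem_coe,
          Finset.mem_range, Set.mem_ofPred_eq, Set.mem_insert_iff, Set.mem_singleton_iff]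
        constructor
        · rintro ⟨i, hi, rfl⟩
          refine ⟨i / 2, by omega, ?_⟩
          rcases Nat.even_or_odd' i with ⟨j, rfl | rfl⟩
          · left; congr 2; omega
          · right; congr 2; omega
        · rintro ⟨i, hi, rfl | rfl⟩
          · exact ⟨2 * i, by omega, rfl⟩
          · exact ⟨2 * i + 1, by omega, rfl⟩
      · rw [hm]; simp
    · obtain ⟨n, rfl⟩ : ∃ n, k = n + 3 := by
        obtain ⟨m, hm⟩ := ho
        exact ⟨k - 3, by omega⟩
      have := PartDec.cycle (H := H) n ho (fun i => σ^[(i : ℕ)] x)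
        (fun i j h => Fin.ext (hinj _ i.2 _ j.2 h))
        (fun i => by
          have : ((i + 1 : Fin (n + 3)) : ℕ) = ((i : ℕ) + 1) % (n + 3) := by
            rw [Fin.val_add]; simp
          rw [this, hmod]; exact hadj _)
      convert this using 1
      ext v
      simp only [O, Finset.coe_image, Set.mem_image, Finset.mem_coe, Finset.mem_range,
        Set.mem_range]
      constructor
      · rintro ⟨i, hi, rfl⟩; exact ⟨⟨i, hi⟩, rfl⟩
      · rintro ⟨i, rfl⟩; exact ⟨i, i.2, rfl⟩
  have := hO.union hrest (by
    rw [← Finset.disjoint_coe.symm]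
    exact Finset.disjoint_sdiff)
  convert this using 1
  · rw [← Finset.coe_union, Finset.union_sdiff_of_subset hOR]
  · rw [Finset.card_sdiff_of_subset hOR, hOcard, Nat.cast_sub (hOcard ▸ Finset.card_le_card hOR)]
    ring

lemma hall_on {V : Type*} [DecidableEq V] (R : Finset V) (t : V → Finset V)
    (h : ∀ S ⊆ R, S.card ≤ (S.biUnion t).card) :
    ∃ f : V → V, Set.InjOn f R ∧ ∀ v ∈ R, f v ∈ t v := by
  obtain ⟨g, hg, hg'⟩ :=
    (Finset.all_card_le_biUnion_card_iff_exists_injective (fun v : R => t v)).1 (by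
      intro s
      have := h (s.map (Function.Embedding.subtype _)) (by
        intro v hv
        obtain ⟨w, _, rfl⟩ := Finset.mem_map.1 hv
        exact w.2)
      rw [Finset.card_map] at this
      refine this.trans (Finset.card_le_card ?_)
      intro v hv
      simp only [Finset.mem_biUnion, Finset.mem_map] at hv ⊢
      obtain ⟨_, ⟨w, hw, rfl⟩, hv⟩ := hv
      exact ⟨w, hw, hv⟩)
  refine ⟨fun v => if hv : v ∈ R then g ⟨v, hv⟩ else v, ?_, ?_⟩
  · intro v hv w hw hvw
    rw [Finset.mem_coe] at hv hw
    simp only [hv, hw, dif_pos] at hvw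
    exact congrArg Subtype.val (hg hvw)
  · intro v hv
    simp only [hv, dif_pos]
    exact hg' ⟨v, hv⟩

/-- Gallai-type construction: an independent set `I` with neighbourhood `N` and a decomposition
whose value matches the dual bound. -/
lemma exists_dec {V : Type*} [Fintype V] [DecidableEq V]
    (H : SimpleGraph V) [DecidableRel H.Adj] (hiso : ∀ v : V, 0 < H.degree v) :
    ∃ I N : Finset V, Disjoint I N ∧ (∀ u ∈ I, ∀ v, H.Adj u v → v ∈ N) ∧
      PartDec H Set.univ ((I.card : ℝ) + ((Finset.univ \ (I ∪ N)).card : ℝ) / 2) := by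
  let nb : Finset V → Finset V := fun S => S.biUnion (fun v => H.neighborFinset v)
  have hnb : ∀ S v, v ∈ nb S ↔ ∃ u ∈ S, H.Adj u v := by intro S v; simp [nb]
  obtain ⟨I, hI, hmax⟩ := Finset.exists_max_image
    ((Finset.univ : Finset (Finset V)).filter (fun S => Disjoint S (nb S)))
    (fun S => (S.card : ℤ) - (nb S).card) ⟨∅, by simp⟩
  simp only [Finset.mem_filter, Finset.mem_univ, true_and] at hI hmax
  have hInd : ∀ u ∈ I, ∀ v ∈ I, ¬ H.Adj u v := fun u hu v hv h =>
    Finset.disjoint_left.1 hI hv ((hnb _ _).2 ⟨u, hu, h⟩)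
  refine ⟨I, nb I, hI, fun u hu v huv => (hnb _ _).2 ⟨u, hu, huv⟩, ?_⟩
  obtain ⟨g, hg, hg'⟩ := hall_on (nb I) (fun v => I.filter (fun u => H.Adj v u)) (by
    intro S hS
    set T := S.biUnion (fun v => I.filter (fun u => H.Adj v u)) with hT
    have hTm : ∀ u, u ∈ T ↔ u ∈ I ∧ ∃ v ∈ S, H.Adj v u := by
      intro u; simp only [hT, Finset.mem_biUnion, Finset.mem_filter]; tauto
    have hTI : T ⊆ I := fun u hu => ((hTm u).1 hu).1
    have hsub : nb (I \ T) ⊆ nb I \ S := by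
      intro v hv
      obtain ⟨u, hu, huv⟩ := (hnb _ _).1 hv
      rw [Finset.mem_sdiff] at hu
      exact Finset.mem_sdiff.2 ⟨(hnb _ _).2 ⟨u, hu.1, huv⟩,
        fun hvS => hu.2 ((hTm u).2 ⟨hu.1, v, hvS, huv.symm⟩)⟩
    have h1 := hmax (I \ T) (Finset.disjoint_of_subset_left Finset.sdiff_subset
      (Finset.disjoint_of_subset_right (hsub.trans Finset.sdiff_subset) hI))
    have h2 := Finset.card_le_card hsub
    rw [Finset.card_sdiff_of_subset hS] at h2
    rw [Finset.card_sdiff_of_subset hTI] at h1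
    have h3 := Finset.card_le_card hTI
    have h4 := Finset.card_le_card hS
    omega)
  set R := Finset.univ \ (I ∪ nb I) with hRdef
  have hRm : ∀ v, v ∈ R ↔ v ∉ I ∧ v ∉ nb I := by intro v; simp [hRdef]
  obtain ⟨s, hs, hs'⟩ := hall_on R (fun v => R.filter (fun u => H.Adj v u)) (by
    intro S hS
    set T := S.biUnion (fun v => R.filter (fun u => H.Adj v u)) with hT
    have hTm : ∀ u, u ∈ T ↔ u ∈ R ∧ ∃ v ∈ S, H.Adj v u := by
      intro u; simp only [hT, Finset.mem_biUnion, Finset.mem_filter]; tauto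
    have hsub : nb (I ∪ (S \ T)) ⊆ nb I ∪ (T \ S) := by
      intro v hv
      obtain ⟨u, hu, huv⟩ := (hnb _ _).1 hv
      rw [Finset.mem_union] at hu ⊢
      by_cases hvI : v ∈ nb I
      · exact Or.inl hvI
      rcases hu with hu | hu
      · exact Or.inl ((hnb _ _).2 ⟨u, hu, huv⟩)
      rw [Finset.mem_sdiff] at hu
      have huR := hS hu.1
      right
      have hvR : v ∈ R := (hRm v).2 ⟨fun hv' => ((hRm u).1 huR).2
        ((hnb _ _).2 ⟨v, hv', huv.symm⟩), hvI⟩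
      refine Finset.mem_sdiff.2 ⟨(hTm v).2 ⟨hvR, u, hu.1, huv⟩, fun hvS => hu.2 ?_⟩
      exact (hTm u).2 ⟨huR, v, hvS, huv.symm⟩
    have hdis : Disjoint (I ∪ (S \ T)) (nb (I ∪ (S \ T))) := by
      refine Finset.disjoint_of_subset_right hsub ?_
      rw [Finset.disjoint_left]
      intro v hv hv'
      rw [Finset.mem_union, Finset.mem_sdiff] at hv hv'
      rcases hv with hv | hv
      · rcases hv' with hv' | hv'
        · exact Finset.disjoint_left.1 hI hv hv'
        · exact ((hRm v).1 ((hTm v).1 hv'.1).1).1 hv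
      · rcases hv' with hv' | hv'
        · exact ((hRm v).1 (hS hv.1)).2 hv'
        · exact hv.2 hv'.1
    have h1 := hmax _ hdis
    have h2 := (Finset.card_le_card hsub).trans (Finset.card_union_le _ _)
    rw [Finset.card_union_of_disjoint (by
      rw [Finset.disjoint_left]
      intro v hv hv'
      exact ((hRm v).1 (hS (Finset.mem_sdiff.1 hv').1)).1 hv)] at h1
    have h3 := Finset.card_sdiff_add_card_inter S T
    have h4 := Finset.card_sdiff_add_card_inter T S
    rw [Finset.inter_comm] at h4
    omega)
  have hRdec : PartDec H (R : Set V) ((R.card : ℝ) / 2) := by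
    refine PartDec.perm (fun v => if v ∈ R then s v else v) ?_ R ?_
    · intro v w hvw
      dsimp only at hvw
      split_ifs at hvw with h1 h2 h2
      · exact hs h1 h2 hvw
      · exact (h2 (hvw ▸ (Finset.mem_filter.1 (hs' v h1)).1)).elim
      · exact (h1 (hvw ▸ (Finset.mem_filter.1 (hs' w h2)).1)).elim
      · exact hvw
    · intro v hv
      simp only [hv, if_true]
      exact Finset.mem_filter.1 (hs' v hv)
  have hc : ∀ u, ∃ a, u ∈ I → (a ∈ nb I ∧ H.Adj a u ∧ ∀ b ∈ nb I, g b = u → b = a) := by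
    intro u
    by_cases hu : u ∈ I
    · by_cases hb : ∃ b ∈ nb I, g b = u
      · obtain ⟨b, hb, hbu⟩ := hb
        refine ⟨b, fun _ => ⟨hb, ?_, fun b' hb' h => hg hb' hb (h.trans hbu.symm)⟩⟩
        rw [← hbu]; exact (Finset.mem_filter.1 (hg' b hb)).2
      · obtain ⟨a, ha⟩ := (H.degree_pos_iff_exists_adj u).1 (hiso u)
        exact ⟨a, fun _ => ⟨(hnb _ _).2 ⟨u, hu, ha⟩, ha.symm,
          fun b hb' h => (hb ⟨b, hb', h⟩).elim⟩⟩
    · exact ⟨u, fun h => (hu h).elim⟩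
  choose c hc using hc
  have hst := PartDec.biUnion (H := H) (nb I)
    (fun a => insert a ((I.filter (fun u => c u = a) : Finset V) : Set V))
    (fun a => ((I.filter (fun u => c u = a)).card : ℝ))
    (by
      intro a ha
      have hga := Finset.mem_filter.1 (hg' a ha)
      refine PartDec.star a _ ⟨g a, Finset.mem_filter.2 ⟨hga.1, ?_⟩⟩ ?_
      · exact ((hc _ hga.1).2.2 a ha rfl).symm
      · intro b hb
        obtain ⟨hb1, hb2⟩ := Finset.mem_filter.1 hb
        rw [← hb2]; exact (hc b hb1).2.1)
    (by
      intro a ha b hb hab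
      rw [Set.disjoint_left]
      intro v hv hw
      simp only [Finset.coe_filter, Set.mem_insert_iff, Set.mem_ofPred_eq] at hv hw
      rcases hv with rfl | hv <;> rcases hw with rfl | hw
      · exact hab rfl
      · exact Finset.disjoint_left.1 hI hw.1 ha
      · exact Finset.disjoint_left.1 hI hv.1 hb
      · exact hab (hv.2.symm.trans hw.2))
  have hmem : ∀ v, v ∈ {v | ∃ a ∈ nb I,
      v ∈ insert a ((I.filter (fun u => c u = a) : Finset V) : Set V)} ↔ v ∈ nb I ∨ v ∈ I := by
    intro v
    simp only [Finset.coe_filter, Set.mem_insert_iff, Set.mem_ofPred_eq]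
    constructor
    · rintro ⟨a, ha, rfl | h⟩
      · exact Or.inl ha
      · exact Or.inr h.1
    · rintro (h | h)
      · exact ⟨v, h, Or.inl rfl⟩
      · exact ⟨c v, (hc v h).1, Or.inr ⟨h, rfl⟩⟩
  have hall := hst.union hRdec (by
    rw [Set.disjoint_left]
    intro v hv hv'
    have h1 := (hmem v).1 hv
    have h2 := (hRm v).1 hv'
    tauto)
  convert hall using 1
  · ext v
    rw [Set.mem_union, hmem, Finset.mem_coe, hRm]
    simp only [Set.mem_univ, true_iff]
    tauto
  · congr 1
    rw [Finset.card_eq_sum_card_fiberwise (f := c) (t := nb I) (fun u hu => (hc u hu).1)]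
    push_cast
    rfl

lemma sum_incidence {V : Type*} [Fintype V] [DecidableEq V]
    (H : SimpleGraph V) [DecidableRel H.Adj] (f : Sym2 V → ℝ) (v : V) :
    ∑ e ∈ H.incidenceFinset v, f e = ∑ e ∈ H.edgeFinset, if v ∈ e then f e else 0 := by
  rw [← Finset.sum_filter]
  congr 1
  ext e
  simp [incidenceSet]

/-- Weak duality. -/
lemma dual_bound {V : Type*} [Fintype V] [DecidableEq V]
    (H : SimpleGraph V) [DecidableRel H.Adj] (I N : Finset V) (hIN : Disjoint I N)
    (hN : ∀ u ∈ I, ∀ v, H.Adj u v → v ∈ N) (f : Sym2 V → ℝ) (hf : IsFracEdgeCover H f) :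
    (I.card : ℝ) + ((Finset.univ \ (I ∪ N)).card : ℝ) / 2 ≤ coverCost H f := by
  obtain ⟨h0, -, h2⟩ := hf
  let y : V → ℝ := fun v => if v ∈ I then 1 else if v ∈ N then 0 else 1 / 2
  have hy0 : ∀ v, 0 ≤ y v := by intro v; simp only [y]; split_ifs <;> norm_num
  have hsum : ∑ v, y v = (I.card : ℝ) + ((Finset.univ \ (I ∪ N)).card : ℝ) / 2 := by
    have : ∀ v, y v = (if v ∈ I then 1 else 0) +
        (if v ∈ Finset.univ \ (I ∪ N) then 1 else 0) / 2 := by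
      intro v
      have : v ∈ I → v ∉ N := fun h => Finset.disjoint_left.1 hIN h
      by_cases h1 : v ∈ I <;> by_cases h2 : v ∈ N <;> simp [y, h1, h2]
    simp only [this, Finset.sum_add_distrib, ← Finset.sum_div, Finset.sum_ite_mem,
      Finset.univ_inter, Finset.sum_const]
    simp
  have hyadj : ∀ u v, H.Adj u v → y u + y v ≤ 1 := by
    intro u v huv
    have a1 := hN u
    have a2 := hN v
    have d1 : u ∈ I → u ∉ N := fun h => Finset.disjoint_left.1 hIN h
    have d2 : v ∈ I → v ∉ N := fun h => Finset.disjoint_left.1 hIN h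
    by_cases h1 : u ∈ I
    · have := a1 h1 v huv
      have hvI : v ∉ I := fun h => d2 h this
      simp [y, h1, this, hvI]
    · by_cases h2 : v ∈ I
      · have := a2 h2 u huv.symm
        simp [y, h1, h2, this]
      · simp only [y, h1, h2, if_false]
        split_ifs <;> norm_num
  rw [← hsum]
  calc ∑ v, y v ≤ ∑ v, y v * ∑ e ∈ H.incidenceFinset v, f e :=
        Finset.sum_le_sum fun v _ => le_mul_of_one_le_right (hy0 v) (h2 v)
    _ = ∑ e ∈ H.edgeFinset, ∑ v, (if v ∈ e then y v else 0) * f e := by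
        simp only [sum_incidence, Finset.mul_sum]
        rw [Finset.sum_comm]
        refine Finset.sum_congr rfl fun e _ => Finset.sum_congr rfl fun v _ => ?_
        split_ifs <;> simp
    _ ≤ ∑ e ∈ H.edgeFinset, f e := by
        refine Finset.sum_le_sum fun e he => ?_
        rw [← Finset.sum_mul]
        refine mul_le_of_le_one_left (h0 e) ?_
        induction e using Sym2.ind with
        | _ u v =>
          have huv : H.Adj u v := by simpa using he
          have : ∀ w, (if w ∈ s(u, v) then y w else 0) =
              (if w = u then y w else 0) + (if w = v then y w else 0) := by
            intro w
            have := huv.ne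
            by_cases h1 : w = u
            · subst h1; simp [this]
            · simp [h1]
          simp only [this, Finset.sum_add_distrib, Finset.sum_ite_eq', Finset.mem_univ, if_true]
          exact hyadj u v huv

lemma two_le_nbrs {V : Type*} [Fintype V] {H : SimpleGraph V} (K : H.Subgraph)
    (h : IsOddCycleGraph K.coe) (v : V) (hv : v ∈ K.verts) :
    ∃ a b, a ≠ b ∧ K.Adj v a ∧ K.Adj v b := by
  obtain ⟨k, -, hk, ⟨φ⟩⟩ := h
  obtain ⟨n, rfl⟩ : ∃ n, k = n + 3 := ⟨k - 3, by omega⟩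
  have hd : (cycleGraph (n + 3)).degree (φ ⟨v, hv⟩) = 2 := cycleGraph_degree_three_le
  rw [← card_neighborFinset_eq_degree, Finset.card_eq_two] at hd
  obtain ⟨a, b, hab, hs⟩ := hd
  have ha : (cycleGraph (n + 3)).Adj (φ ⟨v, hv⟩) a := by
    rw [← mem_neighborFinset, hs]; simp
  have hb : (cycleGraph (n + 3)).Adj (φ ⟨v, hv⟩) b := by
    rw [← mem_neighborFinset, hs]; simp
  refine ⟨φ.symm a, φ.symm b, fun h => hab (φ.symm.injective (Subtype.ext h)), ?_, ?_⟩
  · have := (φ.symm.map_adj_iff).2 ha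
    simpa using this
  · have := (φ.symm.map_adj_iff).2 hb
    simpa using this

lemma one_le_nbrs {V : Type*} {H : SimpleGraph V} (K : H.Subgraph)
    (h : IsStarGraph K.coe) (v : V) (hv : v ∈ K.verts) : ∃ a, K.Adj v a := by
  obtain ⟨p, hp, ⟨φ⟩⟩ := h
  have : ∃ a, (completeBipartiteGraph (Fin 1) (Fin p)).Adj (φ ⟨v, hv⟩) a := by
    rcases φ ⟨v, hv⟩ with i | i
    · exact ⟨Sum.inr ⟨0, hp⟩, by simp⟩
    · exact ⟨Sum.inl 0, by simp⟩
  obtain ⟨a, ha⟩ := this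
  refine ⟨φ.symm a, ?_⟩
  have := (φ.symm.map_adj_iff).2 ha
  simpa using this

/-- Every valid decomposition yields a fractional edge cover of the same cost. -/
lemma cover_of_dec {V : Type*} [Fintype V] [DecidableEq V]
    (H : SimpleGraph V) [DecidableRel H.Adj] (D : ValidDecomposition H) :
    ∃ f, IsFracEdgeCover H f ∧ coverCost H f = decompValue D := by
  classical
  let w : Fin D.t → ℝ := fun i => if IsOddCycleGraph (D.comp i).coe then 1 / 2 else 1
  have hw : ∀ i, 0 ≤ w i := by intro i; simp only [w]; split_ifs <;> norm_num
  have hterm : ∀ i e, 0 ≤ (if e ∈ (D.comp i).edgeSet then w i else 0) := by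
    intro i e; split_ifs; exacts [hw i, le_rfl]
  refine ⟨fun e => ∑ i, if e ∈ (D.comp i).edgeSet then w i else 0, ⟨?_, ?_, ?_⟩, ?_⟩
  · exact fun e => Finset.sum_nonneg fun i _ => hterm i e
  · intro e he
    refine Finset.sum_eq_zero fun i _ => if_neg fun h => he ((D.comp i).edgeSet_subset h)
  · intro v
    obtain ⟨i, hi⟩ := D.covers v
    rw [Finset.sum_comm]
    refine le_trans ?_ (Finset.single_le_sum
      (f := fun j => ∑ e ∈ H.incidenceFinset v, if e ∈ (D.comp j).edgeSet then w j else 0)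
      (fun j _ => Finset.sum_nonneg fun e _ => hterm j e) (Finset.mem_univ i))
    have hin : ∀ a, (D.comp i).Adj v a → s(v, a) ∈ H.incidenceFinset v := by
      intro a ha
      simpa using (D.comp i).adj_sub ha
    by_cases ho : IsOddCycleGraph (D.comp i).coe
    · obtain ⟨a, b, hab, ha, hb⟩ := two_le_nbrs _ ho v hi
      have hne : s(v, a) ≠ s(v, b) := by
        intro h; exact hab (Sym2.congr_right.1 h)
      refine le_trans ?_ (Finset.sum_le_sum_of_subset_of_nonneg
        (s := {s(v, a), s(v, b)}) ?_ fun e _ _ => hterm i e)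
      · rw [Finset.sum_pair hne, if_pos (Subgraph.mem_edgeSet.2 ha),
          if_pos (Subgraph.mem_edgeSet.2 hb)]
        simp only [w, if_pos ho]; norm_num
      · intro e he
        rw [Finset.mem_insert, Finset.mem_singleton] at he
        rcases he with rfl | rfl
        exacts [hin a ha, hin b hb]
    · obtain ⟨a, ha⟩ := one_le_nbrs _ ((D.cycleOrStar i).resolve_left ho) v hi
      refine le_trans ?_ (Finset.single_le_sum (fun e _ => hterm i e) (hin a ha))
      rw [if_pos (Subgraph.mem_edgeSet.2 ha)]
      simp only [w, if_neg ho]; exact le_rfl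
  · unfold coverCost decompValue
    rw [Finset.sum_comm]
    refine Finset.sum_congr rfl fun i _ => ?_
    rw [← Finset.sum_filter, Finset.sum_const]
    have : (((H.edgeFinset.filter (fun e => e ∈ (D.comp i).edgeSet)) : Finset (Sym2 V)) :
        Set (Sym2 V)) = (D.comp i).edgeSet := by
      ext e
      simp only [Finset.coe_filter, mem_edgeFinset, Set.mem_ofPred_eq]
      exact ⟨fun h => h.2, fun h => ⟨(D.comp i).edgeSet_subset h, h⟩⟩
    rw [← Set.ncard_coe_finset, this]
    simp only [w]
    split_ifs
    · simp; ring
    · simp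

lemma PartDec.toValid {V : Type*} {H : SimpleGraph V} {c : ℝ} (h : PartDec H Set.univ c) :
    ∃ D : ValidDecomposition H, decompValue D ≤ c := by
  obtain ⟨ι, _, f, f1, f2, f3, f4⟩ := h
  let e := Fintype.equivFin ι
  refine ⟨⟨Fintype.card ι, fun i => f (e.symm i), fun i j hij => f1 _ _ (e.symm.injective.ne hij),
    fun v => ?_, fun i => f3 _⟩, ?_⟩
  · obtain ⟨i, hi⟩ := (f2 v).1 trivial
    exact ⟨e i, by simpa using hi⟩
  · refine le_trans (le_of_eq ?_) f4
    exact e.symm.sum_comp (fun i => compVal (f i))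

/-- For every finite simple graph `H` with no isolated vertices, the set of
valid decompositions of `H` is nonempty, and the fractional edge cover number `ρ(H)` is the
minimum decomposition value `min_D ρ(D)`. -/
theorem fracEdgeCoverNumber_eq_min_decompValue {V : Type*} [Fintype V] [DecidableEq V]
    (H : SimpleGraph V) [DecidableRel H.Adj] (hiso : ∀ v : V, 0 < H.degree v) :
    Nonempty (ValidDecomposition H) ∧
      IsLeast {x : ℝ | ∃ D : ValidDecomposition H, decompValue D = x}
        (fracEdgeCoverNumber H) := by
  obtain ⟨I, N, hIN, hN, hdec⟩ := exists_dec H hiso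
  obtain ⟨D, hD⟩ := hdec.toValid
  have hbdd : BddBelow (coverCost H '' {f | IsFracEdgeCover H f}) :=
    ⟨_, by rintro _ ⟨f, hf, rfl⟩; exact dual_bound H I N hIN hN f hf⟩
  have hle : ∀ D : ValidDecomposition H, fracEdgeCoverNumber H ≤ decompValue D := by
    intro D
    obtain ⟨f, hf, hfc⟩ := cover_of_dec H D
    rw [← hfc]
    exact csInf_le hbdd ⟨f, hf, rfl⟩
  refine ⟨⟨D⟩, ⟨D, le_antisymm ?_ (hle D)⟩, ?_⟩
  · obtain ⟨f, hf, -⟩ := cover_of_dec H D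
    refine le_csInf ⟨_, f, hf, rfl⟩ ?_
    rintro _ ⟨f, hf, rfl⟩
    exact hD.trans (dual_bound H I N hIN hN f hf)
  · rintro _ ⟨D, rfl⟩
    exact hle D
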